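/- arXiv:2307.11403 — 3 statements merged into one kernel-verified Lean document; each statement's English description precedes it below -/
import Mathlib

section
/- Let N_B, N_U, N_R, L₁, L₂ be positive integers, θ_B, φ_R ∈ [0,π]^{L₁}, θ_R, φ_U ∈ [0,π]^{L₂}, ρ_BR ∈ ℂ^{L₁}, ρ_RU ∈ ℂ^{L₂}, and ω ∈ ℂ^{N_R}. Let κ ∈ ℂ with κ ≠ 0 and ξ ∈ ℝ be such that cos(φ_{R,l₁}) + ξ ∈ [−1,1] for every l₁ and cos(θ_{R,l₂}) + ξ ∈ [−1,1] for every l₂. Define ρ'_BR = κ·ρ_BR, ρ'_RU = κ^{−1}·ρ_RU, φ'_{R,l₁} = arccos(cos(φ_{R,l₁}) + ξ), and θ'_{R,l₂} = arccos(cos(θ_{R,l₂}) + ξ). Then A_{N_U}(φ_U) · diag(ρ'_RU) · A_{N_R}(θ'_R)^H · diag(ω) · A_{N_R}(φ'_R) · diag(ρ'_BR) · A_{N_B}(θ_B)^H = A_{N_U}(φ_U) · diag(ρ_RU) · A_{N_R}(θ_R)^H · diag(ω) · A_{N_R}(φ_R) · diag(ρ_BR) · A_{N_B}(θ_B)^H;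 in particular, the cascaded channel matrix does not uniquely determine the parameters (φ_R, θ_R, ρ_BR, ρ_RU). -/
open scoped ComplexOrder
open Matrix

/-- Steering vector of an `N`-element ULA: entry `n` (0-indexed) is `exp(iπ n cos θ)`,
matching `[a_N(θ)]_m = exp(iπ(m−1)cos θ)` for 1-indexed `m`. -/
noncomputable def steer (N : ℕ) (θ : ℝ) : Fin N → ℂ :=
  fun n => Complex.exp (Complex.I * (Real.pi * Real.cos θ * (n : ℕ)))

/-- Kronecker product `a_{N_B}(θ) ⊗ a_{N_U}(φ)`, indexed by pairs. -/
noncomputable def steerBU (NB NU : ℕ) (θ φ : ℝ) : Fin NB × Fin NU → ℂ :=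
  fun p => steer NB θ p.1 * steer NU φ p.2

/-- The matrix `A_N(θ)` whose `l`-th column is the steering vector `a_N(θ_l)`. -/
noncomputable def steerMat (N : ℕ) {ι : Type} (θ : ι → ℝ) : Matrix (Fin N) ι ℂ :=
  Matrix.of fun n l => steer N (θ l) n

theorem steer_shift (N : ℕ) (a ξ : ℝ) (h : Real.cos a + ξ ∈ Set.Icc (-1 : ℝ) 1) (n : Fin N) :
    steer N (Real.arccos (Real.cos a + ξ)) n
      = Complex.exp (((Real.pi * ξ * (n : ℕ) : ℝ) : ℂ) * Complex.I) * steer N a n := by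
  unfold steer
  rw [Real.cos_arccos h.1 h.2, ← Complex.exp_add]
  congr 1
  push_cast
  ring

theorem phase_cancel (t : ℝ) :
    star (Complex.exp ((t : ℂ) * Complex.I)) * Complex.exp ((t : ℂ) * Complex.I) = 1 := by
  rw [Complex.star_def, ← Complex.exp_conj, ← Complex.exp_add]
  simp

/-- **Proposition 1, parameter ambiguity.**
Rescaling the path gains by `κ` and `κ⁻¹` and shifting all cosines at the RIS by `ξ`
leaves the cascaded channel matrix unchanged, so the parameters
`(φ_R, θ_R, ρ_BR, ρ_RU)` cannot be uniquely identified from it. -/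
theorem cascaded_channel_parameter_ambiguity
    (NB NU NR L₁ L₂ : ℕ) (hNB : 0 < NB) (hNU : 0 < NU) (hNR : 0 < NR)
    (hL₁ : 0 < L₁) (hL₂ : 0 < L₂)
    (θB φR : Fin L₁ → ℝ) (θR φU : Fin L₂ → ℝ)
    (hθB : ∀ l, θB l ∈ Set.Icc 0 Real.pi) (hφR : ∀ l, φR l ∈ Set.Icc 0 Real.pi)
    (hθR : ∀ l, θR l ∈ Set.Icc 0 Real.pi) (hφU : ∀ l, φU l ∈ Set.Icc 0 Real.pi)
    (ρBR : Fin L₁ → ℂ) (ρRU : Fin L₂ → ℂ) (ω : Fin NR → ℂ)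
    (κ : ℂ) (hκ : κ ≠ 0) (ξ : ℝ)
    (hξφ : ∀ l, Real.cos (φR l) + ξ ∈ Set.Icc (-1 : ℝ) 1)
    (hξθ : ∀ l, Real.cos (θR l) + ξ ∈ Set.Icc (-1 : ℝ) 1) :
    steerMat NU φU * Matrix.diagonal (fun l => κ⁻¹ * ρRU l) *
        (steerMat NR (fun l => Real.arccos (Real.cos (θR l) + ξ)))ᴴ *
        Matrix.diagonal ω *
        steerMat NR (fun l => Real.arccos (Real.cos (φR l) + ξ)) *
        Matrix.diagonal (fun l => κ * ρBR l) * (steerMat NB θB)ᴴ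
      = steerMat NU φU * Matrix.diagonal ρRU * (steerMat NR θR)ᴴ *
        Matrix.diagonal ω * steerMat NR φR * Matrix.diagonal ρBR * (steerMat NB θB)ᴴ := by
  have hmid : (steerMat NR (fun l => Real.arccos (Real.cos (θR l) + ξ)))ᴴ *
        Matrix.diagonal ω * steerMat NR (fun l => Real.arccos (Real.cos (φR l) + ξ))
      = (steerMat NR θR)ᴴ * Matrix.diagonal ω * steerMat NR φR := by
    ext i j
    rw [Matrix.mul_apply, Matrix.mul_apply]
    refine Finset.sum_congr rfl fun n _ => ?_
    rw [Matrix.mul_diagonal, Matrix.mul_diagonal]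
    simp only [steerMat, Matrix.conjTranspose_apply, Matrix.of_apply]
    rw [steer_shift NR _ ξ (hξθ i) n, steer_shift NR _ ξ (hξφ j) n, star_mul']
    have h := phase_cancel (Real.pi * ξ * (n : ℕ))
    linear_combination (star (steer NR (θR i) n) * ω n * steer NR (φR j) n) * h
  have h1 : Matrix.diagonal (fun l => κ⁻¹ * ρRU l) = κ⁻¹ • Matrix.diagonal ρRU := by
    rw [← Matrix.diagonal_smul]
    rfl
  have h2 : Matrix.diagonal (fun l => κ * ρBR l) = κ • Matrix.diagonal ρBR := by
    rw [← Matrix.diagonal_smul]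
    rfl
  simp only [Matrix.mul_assoc] at hmid ⊢
  rw [h1, h2]
  simp only [Matrix.smul_mul, Matrix.mul_smul, smul_smul, mul_inv_cancel₀ hκ,
    inv_mul_cancel₀ hκ, one_smul]
  have := congrArg (fun M => steerMat NU φU * (Matrix.diagonal ρRU *
    (M * (Matrix.diagonal ρBR * (steerMat NB θB)ᴴ)))) hmid
  simpa only [Matrix.mul_assoc] using this
end

section
/- Let N_B, N_U, N_R, L₁, L₂ be positive integers, θ_B, φ_R ∈ [0,π]^{L₁}, θ_R, φ_U ∈ [0,π]^{L₂}, ρ_BR ∈ ℂ^{L₁}, ρ_RU ∈ ℂ^{L₂}. Define the BS-to-RIS channel H_BR = A_{N_R}(φ_R) diag(ρ_BR) A_{N_B}(θ_B)^H ∈ ℂ^{N_R×N_B} and the RIS-to-UE channel H_RU = A_{N_U}(φ_U) diag(ρ_RU) A_{N_R}(θ_R)^H ∈ ℂ^{N_U×N_R}. Suppose ψ ∈ [0,π]^{L₁L₂} satisfies that cos(ψ_{(l₁−1)L₂+l₂}) − (cos(θ_{R,l₂}) − cos(φ_{R,l₁})) is an even integer for all l₁ ∈ {1,…,L₁}, l₂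 ∈ {1,…,L₂}. Then H_BR^T ⋄ H_RU = (conj(A_{N_B}(θ_B)) ⊗ A_{N_U}(φ_U)) · diag(ρ_BR ⊗ ρ_RU) · A_{N_R}(ψ)^H. -/
open scoped ComplexOrder
open Matrix

open scoped Kronecker

theorem steer_key (N : ℕ) (φ θ ψ : ℝ) (k : ℤ)
    (h : Real.cos ψ - (Real.cos θ - Real.cos φ) = 2 * k) (n : Fin N) :
    steer N φ n * star (steer N θ n) = star (steer N ψ n) := by
  have hc : Real.cos φ = Real.cos θ - Real.cos ψ + 2 * k := by linarith
  have e : ∀ x : ℝ, star (steer N x n)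
      = Complex.exp (-(Complex.I * (Real.pi * Real.cos x * (n : ℕ)))) := by
    intro x
    unfold steer
    rw [← starRingEnd_apply, ← Complex.exp_conj]
    congr 1
    simp only [map_mul, Complex.conj_I, Complex.conj_ofReal, map_natCast]
    ring
  rw [e, e]
  unfold steer
  rw [← Complex.exp_add, Complex.exp_eq_exp_iff_exists_int]
  refine ⟨k * (n : ℕ), ?_⟩
  rw [hc]
  push_cast
  ring

/-- **effective channel model, eq. (10).**
The Khatri–Rao product `H_BRᵀ ⋄ H_RU` equals
`(conj(A_{N_B}(θ_B)) ⊗ A_{N_U}(φ_U)) diag(ρ_BR ⊗ ρ_RU) A_{N_R}(ψ)ᴴ`, where `ψ` is any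
family of differential angles whose cosines agree (mod even integers) with
`cos θ_R − cos φ_R`. -/
theorem effective_channel_model
    (NB NU NR L₁ L₂ : ℕ) (hNB : 0 < NB) (hNU : 0 < NU) (hNR : 0 < NR)
    (hL₁ : 0 < L₁) (hL₂ : 0 < L₂)
    (θB φR : Fin L₁ → ℝ) (θR φU : Fin L₂ → ℝ)
    (hθB : ∀ l, θB l ∈ Set.Icc 0 Real.pi) (hφR : ∀ l, φR l ∈ Set.Icc 0 Real.pi)
    (hθR : ∀ l, θR l ∈ Set.Icc 0 Real.pi) (hφU : ∀ l, φU l ∈ Set.Icc 0 Real.pi)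
    (ρBR : Fin L₁ → ℂ) (ρRU : Fin L₂ → ℂ)
    (ψ : Fin L₁ × Fin L₂ → ℝ) (hψ : ∀ l, ψ l ∈ Set.Icc 0 Real.pi)
    (hψeq : ∀ (l₁ : Fin L₁) (l₂ : Fin L₂), ∃ k : ℤ,
      Real.cos (ψ (l₁, l₂)) - (Real.cos (θR l₂) - Real.cos (φR l₁)) = 2 * k) :
    -- `H_BRᵀ ⋄ H_RU`, the Khatri–Rao product, with
    -- `H_BR = A_{N_R}(φ_R) diag(ρ_BR) A_{N_B}(θ_B)ᴴ` and
    -- `H_RU = A_{N_U}(φ_U) diag(ρ_RU) A_{N_R}(θ_R)ᴴ`: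
    (Matrix.of fun (j : Fin NB × Fin NU) (k : Fin NR) =>
        (steerMat NR φR * Matrix.diagonal ρBR * (steerMat NB θB)ᴴ)ᵀ j.1 k *
        (steerMat NU φU * Matrix.diagonal ρRU * (steerMat NR θR)ᴴ) j.2 k)
      = ((steerMat NB θB).map (starRingEnd ℂ) ⊗ₖ steerMat NU φU) *
        Matrix.diagonal (fun q : Fin L₁ × Fin L₂ => ρBR q.1 * ρRU q.2) *
        (steerMat NR ψ)ᴴ := by
  ext j n
  simp only [Matrix.of_apply, Matrix.transpose_apply]
  rw [Matrix.mul_apply, Matrix.mul_apply, Matrix.mul_apply, Finset.sum_mul_sum,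
    Fintype.sum_prod_type]
  refine Finset.sum_congr rfl fun a _ => Finset.sum_congr rfl fun b _ => ?_
  obtain ⟨k, hk⟩ := hψeq a b
  simp only [Matrix.mul_diagonal, Matrix.conjTranspose_apply, Matrix.kroneckerMap_apply,
    Matrix.map_apply, steerMat, Matrix.of_apply, starRingEnd_apply]
  rw [← steer_key NR (φR a) (θR b) (ψ (a, b)) k hk n]
  ring
end

section
/- Let m, n, L₁, L₂ be positive integers, A ∈ ℂ^{n×L₁} with full column rank, B ∈ ℂ^{m×L₂} with full column rank, p ∈ ℝ^{L₁} with p_l > 0, q ∈ ℝ^{L₂} with q_i > 0, and H ∈ ℂ^{m×n}. If the block matrix [[A diag(p) A^H, H^H],[H, B diag(q) B^H]] is positive semidefinite, then there exists a matrix C ∈ ℂ^{L₂×L₁} such that H = B C A^H. -/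
open scoped ComplexOrder
open Matrix

theorem exists_left_inv_aux {n L : ℕ} (A : Matrix (Fin n) (Fin L) ℂ)
    (hA : LinearIndependent ℂ (fun l => Aᵀ l)) : ∃ A' : Matrix (Fin L) (Fin n) ℂ, A' * A = 1 := by
  have hi : Function.Injective A.mulVec := Matrix.mulVec_injective_iff.2 hA
  obtain ⟨g, hg⟩ := LinearMap.exists_leftInverse_of_injective (Matrix.toLin' A)
    (LinearMap.ker_eq_bot.2 hi)
  refine ⟨LinearMap.toMatrix' g, ?_⟩
  have h := congrArg LinearMap.toMatrix' hg
  simpa [LinearMap.toMatrix'_comp] using h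

/-- **column inclusion step in the proof of Theorem 1.** If the block matrix
`[[A diag(p) Aᴴ, Hᴴ],[H, B diag(q) Bᴴ]]` is positive semidefinite, with `A`, `B` of full
column rank and `p`, `q` positive, then `H = B C Aᴴ` for some matrix `C`. -/
theorem exists_coupling_of_block_psd
    (m n L₁ L₂ : ℕ) (hm : 0 < m) (hn : 0 < n) (hL₁ : 0 < L₁) (hL₂ : 0 < L₂)
    (A : Matrix (Fin n) (Fin L₁) ℂ) (B : Matrix (Fin m) (Fin L₂) ℂ)
    (hA : LinearIndependent ℂ (fun l => Aᵀ l)) (hB : LinearIndependent ℂ (fun i => Bᵀ i))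
    (p : Fin L₁ → ℝ) (hp : ∀ l, 0 < p l) (q : Fin L₂ → ℝ) (hq : ∀ i, 0 < q i)
    (H : Matrix (Fin m) (Fin n) ℂ)
    (hPSD : (Matrix.fromBlocks (A * Matrix.diagonal (fun l => (p l : ℂ)) * Aᴴ) Hᴴ
      H (B * Matrix.diagonal (fun i => (q i : ℂ)) * Bᴴ)).PosSemidef) :
    ∃ C : Matrix (Fin L₂) (Fin L₁) ℂ, H = B * C * Aᴴ := by
  obtain ⟨A', hA'⟩ := exists_left_inv_aux A hA
  obtain ⟨B', hB'⟩ := exists_left_inv_aux B hB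
  have k1 : ∀ v : Fin n → ℂ, Aᴴ *ᵥ v = 0 → H *ᵥ v = 0 := by
    intro v hv
    have h := (hPSD.dotProduct_mulVec_zero_iff (Sum.elim v 0)).1 (by
      rw [fromBlocks_mulVec]
      simp [dotProduct, ← Matrix.mulVec_mulVec, hv])
    rw [fromBlocks_mulVec] at h
    have h2 := congrArg (fun f => f ∘ Sum.inr) h
    simpa using h2
  have k2 : ∀ v : Fin m → ℂ, Bᴴ *ᵥ v = 0 → Hᴴ *ᵥ v = 0 := by
    intro v hv
    have h := (hPSD.dotProduct_mulVec_zero_iff (Sum.elim 0 v)).1 (by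
      rw [fromBlocks_mulVec]
      simp [dotProduct, ← Matrix.mulVec_mulVec, hv])
    rw [fromBlocks_mulVec] at h
    have h2 := congrArg (fun f => f ∘ Sum.inl) h
    simpa using h2
  have e1 : H = H * (A'ᴴ * Aᴴ) := by
    apply Matrix.toLin'.injective
    apply LinearMap.ext
    intro x
    have h := k1 (x - (A'ᴴ * Aᴴ) *ᵥ x) (by
      rw [Matrix.mulVec_sub, Matrix.mulVec_mulVec, ← Matrix.mul_assoc,
        ← Matrix.conjTranspose_mul, hA']
      simp)
    rw [Matrix.mulVec_sub, Matrix.mulVec_mulVec] at h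
    simpa using sub_eq_zero.1 h
  have e2 : Hᴴ = Hᴴ * (B'ᴴ * Bᴴ) := by
    apply Matrix.toLin'.injective
    apply LinearMap.ext
    intro x
    have h := k2 (x - (B'ᴴ * Bᴴ) *ᵥ x) (by
      rw [Matrix.mulVec_sub, Matrix.mulVec_mulVec, ← Matrix.mul_assoc,
        ← Matrix.conjTranspose_mul, hB']
      simp)
    rw [Matrix.mulVec_sub, Matrix.mulVec_mulVec] at h
    simpa using sub_eq_zero.1 h
  have e3 : H = B * B' * H := by
    have h := congrArg Matrix.conjTranspose e2
    simpa [Matrix.conjTranspose_mul] using h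
  refine ⟨B' * H * A'ᴴ, ?_⟩
  calc H = B * B' * H := e3
    _ = B * B' * (H * (A'ᴴ * Aᴴ)) := by rw [← e1]
    _ = _ := by simp only [Matrix.mul_assoc]
end
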